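/- arXiv:1310.1813 — 6 statements merged into one kernel-verified Lean document; each statement's English description precedes it below -/
import Mathlib

section
/- Let H be a nonzero measure on a measurable space 𝓗 and let L : 𝓗 → (0,∞) be measurable with c_L := ∫⁻ L dH < ∞. Then for every measurable g : 𝓗 → [0,∞] with ∫⁻ g dH = 1, the essential supremum with respect to H of the function f ↦ L(f)/g(f) is at least c_L. -/
open MeasureTheory ENNReal

/-- Lower-bound part: for any probability density `g` w.r.t. `H`, the essential
supremum of `L/g` is at least `∫⁻ L dH`. -/
theorem essSup_div_ge_lintegral
    {𝓗 : Type*} [MeasurableSpace 𝓗] (H : Measure 𝓗) (hH : H ≠ 0)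
    (L : 𝓗 → ℝ≥0∞) (hLmeas : Measurable L)
    (hLpos : ∀ f, 0 < L f) (hLtop : ∀ f, L f < ⊤)
    (hcL : ∫⁻ f, L f ∂H < ⊤)
    (g : 𝓗 → ℝ≥0∞) (hg : Measurable g) (hg1 : ∫⁻ f, g f ∂H = 1) :
    ∫⁻ f, L f ∂H ≤ essSup (fun f => L f / g f) H := by
  set M := essSup (fun f => L f / g f) H
  by_cases hMtop : M = ⊤
  · simp [hMtop]
  have hgfin : ∀ᵐ f ∂H, g f < ⊤ := ae_lt_top hg (by simp [hg1])
  calc ∫⁻ f, L f ∂H ≤ ∫⁻ f, M * g f ∂H := by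
        refine lintegral_mono_ae ?_
        filter_upwards [ENNReal.ae_le_essSup (μ := H) (fun f => L f / g f), hgfin] with f hf hgf
        exact (ENNReal.div_le_iff_le_mul (.inr hMtop) (.inl hgf.ne)).1 hf
    _ = M := by rw [lintegral_const_mul M hg, hg1, mul_one]
end

section
/- Let H be a nonzero measure on a measurable space 𝓗 and let L : 𝓗 → (0,∞) be measurable with c_L := ∫⁻ L dH ∈ (0,∞). Define g*(f) = L(f)/c_L. Then ∫⁻ g* dH = 1 and the essential supremum with respect to H of f ↦ L(f)/g*(f) equals c_L; in particular g* attains the minimal possible value c_L of essSup_H(L/g) over all measurable g ≥ 0 with ∫⁻ g dH = 1. -/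
open MeasureTheory ENNReal

/-- Attainment part: the normalized density `g* = L / c_L` is a probability
density w.r.t. `H`, the essential supremum of `L/g*` equals `c_L`, and `g*`
attains the minimal possible value `c_L` of `essSup (L/g)` over all probability
densities `g`. -/
theorem normalized_density_optimal
    {𝓗 : Type*} [MeasurableSpace 𝓗] (H : Measure 𝓗) (hH : H ≠ 0)
    (L : 𝓗 → ℝ≥0∞) (hLmeas : Measurable L)
    (hLpos : ∀ f, 0 < L f) (hLtop : ∀ f, L f < ⊤)
    (cL : ℝ≥0∞) (hcL : cL = ∫⁻ f, L f ∂H) (hcLpos : 0 < cL) (hcLtop : cL < ⊤) :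
    (∫⁻ f, L f / cL ∂H = 1) ∧
    essSup (fun f => L f / (L f / cL)) H = cL ∧
    (∀ g : 𝓗 → ℝ≥0∞, Measurable g → ∫⁻ f, g f ∂H = 1 →
      cL ≤ essSup (fun f => L f / g f) H) := by
  refine ⟨?_, ?_, fun g hg hg1 => ?_⟩
  · simp_rw [div_eq_mul_inv]
    rw [lintegral_mul_const _ hLmeas, ← hcL, ENNReal.mul_inv_cancel hcLpos.ne' hcLtop.ne]
  · have hquot : (fun f => L f / (L f / cL)) = fun _ => cL := by
      funext f
      exact ENNReal.div_div_cancel (hLpos f).ne' (hLtop f).ne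
    rw [hquot, essSup_const _ hH]
  · rcases eq_or_ne (essSup (fun f => L f / g f) H) ⊤ with hM | hM
    · simp [hM]
    have hle : L ≤ᵐ[H] fun f => essSup (fun f => L f / g f) H * g f := by
      filter_upwards [ENNReal.ae_le_essSup (fun f => L f / g f),
        ae_lt_top hg (by simp [hg1])] with f hf hgf
      exact (ENNReal.div_le_iff_le_mul (Or.inr hM) (Or.inl hgf.ne)).1 hf
    calc cL = ∫⁻ f, L f ∂H := hcL
      _ ≤ ∫⁻ f, essSup (fun f => L f / g f) H * g f ∂H := lintegral_mono_ae hle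
      _ = essSup (fun f => L f / g f) H := by rw [lintegral_const_mul _ hg, hg1, mul_one]
end

section
/- Let H be a measure on a measurable space 𝓗 and let L : 𝓗 → (0,∞) be measurable with c_L := ∫⁻ L dH ∈ (0,∞). If g : 𝓗 → [0,∞] is measurable with ∫⁻ g dH = 1 and the essential supremum with respect to H of f ↦ L(f)/g(f) is at most c_L, then g(f) = L(f)/c_L for H-almost every f. -/
open MeasureTheory ENNReal

/-- Uniqueness part: any probability density `g` with
`essSup (L/g) ≤ c_L = ∫⁻ L dH` coincides `H`-a.e. with the normalized density
`g* = L / c_L`. -/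
theorem minimizer_eq_normalized_density_ae
    {𝓗 : Type*} [MeasurableSpace 𝓗] (H : Measure 𝓗)
    (L : 𝓗 → ℝ≥0∞) (hLmeas : Measurable L)
    (hLpos : ∀ f, 0 < L f) (hLtop : ∀ f, L f < ⊤)
    (cL : ℝ≥0∞) (hcL : cL = ∫⁻ f, L f ∂H) (hcLpos : 0 < cL) (hcLtop : cL < ⊤)
    (g : 𝓗 → ℝ≥0∞) (hg : Measurable g) (hg1 : ∫⁻ f, g f ∂H = 1)
    (hopt : essSup (fun f => L f / g f) H ≤ cL) :
    g =ᵐ[H] fun f => L f / cL := by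
  have hle : (fun f => L f / cL) ≤ᵐ[H] g := by
    filter_upwards [ENNReal.ae_le_essSup fun f => L f / g f] with f hf
    have hmul : L f ≤ cL * g f :=
      (ENNReal.div_le_iff_le_mul (Or.inr hcLtop.ne) (Or.inr hcLpos.ne')).1 (hf.trans hopt)
    exact ENNReal.div_le_of_le_mul' hmul
  have hint : ∫⁻ f, L f / cL ∂H = 1 := by
    simp only [div_eq_mul_inv]
    rw [lintegral_mul_const _ hLmeas, ← hcL]
    exact ENNReal.mul_inv_cancel hcLpos.ne' hcLtop.ne
  exact (ae_eq_of_ae_le_of_lintegral_le hle (by simp [hint]) hg.aemeasurable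
    (by rw [hg1, hint])).symm
end

section
/- Let R ≥ 0 and let f₀ : ℝ → [0,∞] satisfy f₀(s) ≥ f₀(t) whenever 0 ≤ s ≤ t (f₀ is antitone on [0,∞)). Then, with respect to Lebesgue measure on ℝ, ∫⁻_ℝ ( sup_{y ∈ [−R,R]} f₀(|x − y|) ) dx = 2R · f₀(0) + ∫⁻_ℝ f₀(|x|) dx, as an equality in [0,∞]. -/
open MeasureTheory ENNReal

/-- The supremum of an antitone radial profile over translates in `[-R, R]` is its value at
the distance to `[-R, R]`. -/
lemma iSup_Icc_comp_abs_sub {α : Type*} [CompleteLattice α] {R : ℝ} (hR : 0 ≤ R) {f : ℝ → α}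
    (hf : AntitoneOn f (Set.Ici 0)) (x : ℝ) :
    ⨆ y ∈ Set.Icc (-R) R, f |x - y| = f (max (|x| - R) 0) := by
  apply le_antisymm
  · refine iSup₂_le fun y hy => hf (Set.mem_Ici.2 (le_max_right _ _))
      (Set.mem_Ici.2 (abs_nonneg _)) (max_le ?_ (abs_nonneg _))
    have := abs_sub_abs_le_abs_sub x y
    have := abs_le.2 hy
    linarith
  · have hy : max (-R) (min x R) ∈ Set.Icc (-R) R :=
      ⟨le_max_left _ _, max_le (by linarith) (min_le_right _ _)⟩
    have hd : |x - max (-R) (min x R)| = max (|x| - R) 0 := by grind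
    rw [← hd]
    exact le_iSup₂ (f := fun y (_ : y ∈ Set.Icc (-R) R) => f |x - y|) _ hy

/-- Normalizing constant on `K = [-R, R] ⊆ ℝ` for an antitone radially
symmetric shape function:
`∫⁻ (sup_{y ∈ [-R,R]} f₀ |x - y|) dx = 2R·f₀(0) + ∫⁻ f₀ |x| dx`. -/
theorem lintegral_sup_shape_interval
    (R : ℝ) (hR : 0 ≤ R) (f₀ : ℝ → ℝ≥0∞)
    (hf₀ : ∀ s t : ℝ, 0 ≤ s → s ≤ t → f₀ t ≤ f₀ s) :
    ∫⁻ x : ℝ, ⨆ y ∈ Set.Icc (-R) R, f₀ |x - y|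
      = ENNReal.ofReal (2 * R) * f₀ 0 + ∫⁻ x : ℝ, f₀ |x| := by
  have hf : AntitoneOn f₀ (Set.Ici 0) := fun s hs t _ hst => hf₀ s t hs hst
  simp_rw [iSup_Icc_comp_abs_sub hR hf]
  have hmid : ∫⁻ x in Set.Icc (-R) R, f₀ (max (|x| - R) 0) = ENNReal.ofReal (2 * R) * f₀ 0 := by
    rw [setLIntegral_congr_fun (g := fun _ => f₀ 0) measurableSet_Icc, setLIntegral_const,
      Real.volume_Icc, mul_comm]
    · ring_nf
    · intro x hx
      simp only
      rw [max_eq_right (sub_nonpos.2 (abs_le.2 hx))]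
  have hright : ∫⁻ x in Set.Ioi R, f₀ (max (|x| - R) 0) = ∫⁻ x in Set.Ioi 0, f₀ |x| := by
    rw [← (measurePreserving_sub_right volume R).setLIntegral_comp_preimage_emb
      (measurableEmbedding_subRight R) (fun x => f₀ |x|), Set.preimage_sub_const_Ioi, zero_add]
    refine setLIntegral_congr_fun measurableSet_Ioi fun x (hx : R < x) => ?_
    congr 1
    grind
  have hleft : ∫⁻ x in Set.Iio (-R), f₀ (max (|x| - R) 0) = ∫⁻ x in Set.Iic 0, f₀ |x| := by
    rw [← setLIntegral_congr (Iio_ae_eq_Iic (a := (0 : ℝ))),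
      ← (measurePreserving_add_right volume R).setLIntegral_comp_preimage_emb
      (measurableEmbedding_addRight R) (fun x => f₀ |x|), Set.preimage_add_const_Iio, zero_sub]
    refine setLIntegral_congr_fun measurableSet_Iio fun x (hx : x < -R) => ?_
    congr 1
    grind
  have hcompl : (Set.Icc (-R) R)ᶜ = Set.Iio (-R) ∪ Set.Ioi R := by
    ext x
    grind
  have hdisj : Disjoint (Set.Iio (-R)) (Set.Ioi R) :=
    Set.disjoint_left.2 fun x (hx : x < -R) (hx' : R < x) => by linarith
  rw [← lintegral_add_compl _ (measurableSet_Icc (a := -R) (b := R)), hcompl,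
    lintegral_union measurableSet_Ioi hdisj, hmid, hleft, hright,
    ← Set.compl_Iic, lintegral_add_compl _ measurableSet_Iic]
end

section
/- Let d ∈ ℕ, R ≥ 0, and let f₀ : ℝ → [0,∞] satisfy f₀(s) ≥ f₀(t) whenever 0 ≤ s ≤ t (f₀ is antitone on [0,∞)). Then, with respect to Lebesgue measure on EuclideanSpace ℝ (Fin d), ∫⁻ ( sup_{y ∈ closedBall(0,R)} f₀(‖x − y‖) ) dx = f₀(0) · volume(closedBall(0,R)) + ∫⁻_{{x : ‖x‖ > R}} f₀(‖x‖ − R) dx, as an equality in [0,∞]. -/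
open MeasureTheory ENNReal Metric

section SupNormSub

variable {E : Type*} [NormedAddCommGroup E] {f : ℝ → ℝ≥0∞} {R : ℝ} {x : E}

theorem iSup_closedBall_norm_sub_of_norm_le (hf : ∀ s t : ℝ, 0 ≤ s → s ≤ t → f t ≤ f s)
    (hx : ‖x‖ ≤ R) : ⨆ y ∈ closedBall (0 : E) R, f ‖x - y‖ = f 0 := by
  refine le_antisymm (iSup₂_le fun y _ => hf _ _ le_rfl (norm_nonneg _)) ?_
  refine le_iSup₂_of_le x (mem_closedBall_zero_iff.2 hx) ?_
  simp

theorem iSup_closedBall_norm_sub_of_lt_norm [NormedSpace ℝ E]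
    (hf : ∀ s t : ℝ, 0 ≤ s → s ≤ t → f t ≤ f s) (hR : 0 ≤ R) (hx : R < ‖x‖) :
    ⨆ y ∈ closedBall (0 : E) R, f ‖x - y‖ = f (‖x‖ - R) := by
  refine le_antisymm (iSup₂_le fun y hy => hf _ _ (sub_nonneg.2 hx.le) ?_) ?_
  · have hy' : ‖y‖ ≤ R := mem_closedBall_zero_iff.1 hy
    linarith [norm_sub_norm_le x y]
  · have hx0 : 0 < ‖x‖ := hR.trans_lt hx
    have hball : (R / ‖x‖) • x ∈ closedBall (0 : E) R := by
      rw [mem_closedBall_zero_iff, norm_smul, Real.norm_of_nonneg (by positivity),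
        div_mul_cancel₀ _ hx0.ne']
    have hnorm : ‖x - (R / ‖x‖) • x‖ = ‖x‖ - R := by
      have hle : R / ‖x‖ ≤ 1 := (div_le_one hx0).2 hx.le
      rw [show x - (R / ‖x‖) • x = (1 - R / ‖x‖) • x by rw [sub_smul, one_smul], norm_smul,
        Real.norm_of_nonneg (sub_nonneg.2 hle)]
      field_simp
    exact le_iSup₂_of_le _ hball (by rw [hnorm])

end SupNormSub

/-- Normalizing constant on the ball `K = b(0, R) ⊆ ℝ^d` for an antitone
radially symmetric shape function:
`∫⁻ (sup_{y ∈ b(0,R)} f₀ ‖x - y‖) dx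
  = f₀(0) · vol(b(0,R)) + ∫⁻_{‖x‖ > R} f₀ (‖x‖ - R) dx`. -/
theorem lintegral_sup_shape_ball
    (d : ℕ) (R : ℝ) (hR : 0 ≤ R) (f₀ : ℝ → ℝ≥0∞)
    (hf₀ : ∀ s t : ℝ, 0 ≤ s → s ≤ t → f₀ t ≤ f₀ s) :
    ∫⁻ x : EuclideanSpace ℝ (Fin d),
        ⨆ y ∈ closedBall (0 : EuclideanSpace ℝ (Fin d)) R, f₀ ‖x - y‖
      = f₀ 0 * volume (closedBall (0 : EuclideanSpace ℝ (Fin d)) R)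
        + ∫⁻ x in {x : EuclideanSpace ℝ (Fin d) | R < ‖x‖}, f₀ (‖x‖ - R) := by
  have hs : MeasurableSet (closedBall (0 : EuclideanSpace ℝ (Fin d)) R) :=
    measurableSet_closedBall
  have hcompl : (closedBall (0 : EuclideanSpace ℝ (Fin d)) R)ᶜ = {x | R < ‖x‖} := by
    ext x
    simp
  rw [← lintegral_add_compl _ hs,
    setLIntegral_congr_fun hs fun x hx =>
      iSup_closedBall_norm_sub_of_norm_le hf₀ (mem_closedBall_zero_iff.1 hx),
    setLIntegral_const, hcompl]
  exact congrArg _ <| setLIntegral_congr_fun (hcompl ▸ hs.compl) fun x hx =>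
    iSup_closedBall_norm_sub_of_lt_norm hf₀ hR hx
end

section
/- Let σ > 0 and R ≥ 0. Then, with ‖·‖ the Euclidean norm on ℝ², ∫_{ℝ²} ( sup_{y ∈ [−R,R]²} (2πσ²)^{−1} · exp( −‖x − y‖² / (2σ²) ) ) dx = (2/π) · (R/σ)² + 2 √(2/π) · (R/σ) + 1, where [−R,R]² = { y : |y₁| ≤ R and |y₂| ≤ R }. -/
open MeasureTheory Real

/-- The distance from `t` to its projection onto `[-R, R]`. -/
lemma abs_sub_max_neg_min {R : ℝ} (hR : 0 ≤ R) (t : ℝ) :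
    |t - max (-R) (min R t)| = max (|t| - R) 0 := by
  rcases le_total t (-R) with h | h
  · rw [min_eq_right (by linarith), max_eq_left h, abs_of_nonpos (by linarith : t ≤ 0),
      abs_of_nonpos (by linarith), max_eq_left (by linarith)]
    ring
  rcases le_total R t with h' | h'
  · rw [min_eq_left h', max_eq_right (by linarith), abs_of_nonneg (by linarith : 0 ≤ t),
      abs_of_nonneg (by linarith), max_eq_left (by linarith)]
  · rw [min_eq_right h', max_eq_right h, sub_self, abs_zero,
      max_eq_right (by linarith [abs_le.2 ⟨h, h'⟩])]

/-- The supremum of a centred isotropic Gaussian kernel over a cube factorizes; it is attained at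
the projection of `x` onto the cube. -/
lemma iSup_gaussian_cube {ι : Type*} [Fintype ι] {σ R c : ℝ} (hR : 0 ≤ R) (hc : 0 ≤ c)
    (x : EuclideanSpace ℝ ι) :
    ⨆ y ∈ {y : EuclideanSpace ℝ ι | ∀ i, |y i| ≤ R},
        c * Real.exp (-‖x - y‖ ^ 2 / (2 * σ ^ 2))
      = c * ∏ i, Real.exp (-(max (|x i| - R) 0) ^ 2 / (2 * σ ^ 2)) := by
  have hprod : ∏ i, Real.exp (-(max (|x i| - R) 0) ^ 2 / (2 * σ ^ 2))
      = Real.exp (-(∑ i, (max (|x i| - R) 0) ^ 2) / (2 * σ ^ 2)) := by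
    rw [← Real.exp_sum, ← Finset.sum_div, Finset.sum_neg_distrib]
  rw [hprod]
  have hle : ∀ y : EuclideanSpace ℝ ι,
      ⨆ (_ : y ∈ {y : EuclideanSpace ℝ ι | ∀ i, |y i| ≤ R}),
        c * Real.exp (-‖x - y‖ ^ 2 / (2 * σ ^ 2))
      ≤ c * Real.exp (-(∑ i, (max (|x i| - R) 0) ^ 2) / (2 * σ ^ 2)) := by
    intro y
    by_cases hy : y ∈ {y : EuclideanSpace ℝ ι | ∀ i, |y i| ≤ R}
    · rw [ciSup_pos hy, EuclideanSpace.real_norm_sq_eq]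
      have hi : ∀ i, (max (|x i| - R) 0) ^ 2 ≤ ((x - y) i) ^ 2 := by
        intro i
        have h : |x i| - R ≤ |x i - y i| := by
          linarith [abs_sub_abs_le_abs_sub (x i) (y i), hy i]
        rw [PiLp.sub_apply, ← sq_abs (x i - y i)]
        exact pow_le_pow_left₀ (le_max_right _ _) (max_le h (abs_nonneg _)) 2
      have hsum := Finset.sum_le_sum fun i (_ : i ∈ Finset.univ) => hi i
      gcongr
    · have : IsEmpty (y ∈ {y : EuclideanSpace ℝ ι | ∀ i, |y i| ≤ R}) := ⟨hy⟩
      rw [Real.iSup_of_isEmpty]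
      positivity
  refine le_antisymm (ciSup_le hle) ?_
  let p : EuclideanSpace ℝ ι := WithLp.toLp 2 fun i => max (-R) (min R (x i))
  have hp : p ∈ {y : EuclideanSpace ℝ ι | ∀ i, |y i| ≤ R} := fun i =>
    abs_le.2 ⟨le_max_left _ _, max_le (by linarith) (min_le_left _ _)⟩
  refine le_ciSup_of_le ⟨_, Set.forall_mem_range.2 hle⟩ p ?_
  rw [ciSup_pos hp, EuclideanSpace.real_norm_sq_eq]
  refine le_of_eq ?_
  congr 5
  ext i
  change _ = (x i - max (-R) (min R (x i))) ^ 2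
  rw [← sq_abs (x i - _), abs_sub_max_neg_min hR]

/-- The integral of the Gaussian kernel evaluated at the distance to `[-R, R]`. -/
lemma integral_exp_neg_sq_dist_Icc {σ R : ℝ} (hσ : 0 < σ) (hR : 0 ≤ R) :
    ∫ t : ℝ, Real.exp (-(max (|t| - R) 0) ^ 2 / (2 * σ ^ 2)) = 2 * R + σ * √(2 * π) := by
  have hb : (0 : ℝ) < 1 / (2 * σ ^ 2) := by positivity
  let e : ℝ ≃ᵐ ℝ := MeasurableEquiv.addRight R
  have he : MeasurePreserving e := measurePreserving_add_right volume R
  have hpre : e ⁻¹' Set.Ioi R = Set.Ioi 0 := by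
    change (fun t => t + R) ⁻¹' Set.Ioi R = _
    rw [Set.preimage_add_const_Ioi, sub_self]
  have hshift : ∀ t ∈ Set.Ioi (0 : ℝ), Real.exp (-(max (e t - R) 0) ^ 2 / (2 * σ ^ 2))
      = Real.exp (-(1 / (2 * σ ^ 2)) * t ^ 2) := by
    intro t ht
    have : e t - R = t := add_sub_cancel_right t R
    rw [this, max_eq_left (le_of_lt ht)]
    congr 1
    ring
  have hone : ∀ t ∈ Set.Ioc 0 R, Real.exp (-(max (t - R) 0) ^ 2 / (2 * σ ^ 2)) = 1 := by
    intro t ht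
    rw [max_eq_right (by linarith [ht.2])]
    simp
  have hcore : IntegrableOn (fun t => Real.exp (-(max (t - R) 0) ^ 2 / (2 * σ ^ 2)))
      (Set.Ioc 0 R) :=
    Continuous.integrableOn_Ioc (by fun_prop)
  have htail : IntegrableOn (fun t => Real.exp (-(max (t - R) 0) ^ 2 / (2 * σ ^ 2)))
      (Set.Ioi R) := by
    rw [← he.integrableOn_comp_preimage e.measurableEmbedding, hpre]
    exact (integrable_exp_neg_mul_sq hb).integrableOn.congr_fun
      (fun t ht => (hshift t ht).symm) measurableSet_Ioi
  rw [integral_comp_abs (f := fun t => Real.exp (-(max (t - R) 0) ^ 2 / (2 * σ ^ 2))),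
    ← Set.Ioc_union_Ioi_eq_Ioi hR,
    setIntegral_union (Set.Ioc_disjoint_Ioi le_rfl) measurableSet_Ioi hcore htail,
    setIntegral_congr_fun measurableSet_Ioc hone,
    ← he.setIntegral_preimage_emb e.measurableEmbedding _ (Set.Ioi R), hpre,
    setIntegral_congr_fun measurableSet_Ioi hshift, integral_gaussian_Ioi]
  have hsqrt : √(π / (1 / (2 * σ ^ 2))) = σ * √(2 * π) := by
    rw [show π / (1 / (2 * σ ^ 2)) = σ ^ 2 * (2 * π) by field_simp,
      Real.sqrt_mul (by positivity), Real.sqrt_sq hσ.le]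
  rw [hsqrt]
  simp [hR]
  ring

/-- Normalizing constant of the Smith process on the square `K = [-R, R]²`:
`∫ sup_{y ∈ [-R,R]²} (2πσ²)⁻¹ exp(-‖x-y‖²/(2σ²)) dx
  = (2/π)(R/σ)² + 2√(2/π)(R/σ) + 1`. -/
theorem integral_sup_gaussian_square
    (σ R : ℝ) (hσ : 0 < σ) (hR : 0 ≤ R) :
    ∫ x : EuclideanSpace ℝ (Fin 2),
        ⨆ y ∈ {y : EuclideanSpace ℝ (Fin 2) | ∀ i, |y i| ≤ R},
          (2 * π * σ ^ 2)⁻¹ * Real.exp (-‖x - y‖ ^ 2 / (2 * σ ^ 2))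
      = (2 / π) * (R / σ) ^ 2 + 2 * Real.sqrt (2 / π) * (R / σ) + 1 := by
  simp_rw [iSup_gaussian_cube (σ := σ) hR (by positivity : (0 : ℝ) ≤ (2 * π * σ ^ 2)⁻¹)]
  rw [integral_const_mul,
    (PiLp.volume_preserving_ofLp (Fin 2)).integral_comp
      (MeasurableEquiv.toLp 2 (Fin 2 → ℝ)).symm.measurableEmbedding
      (fun x => ∏ i, Real.exp (-(max (|x i| - R) 0) ^ 2 / (2 * σ ^ 2))),
    integral_fintype_prod_volume_eq_pow
      (fun t : ℝ => Real.exp (-(max (|t| - R) 0) ^ 2 / (2 * σ ^ 2))),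
    integral_exp_neg_sq_dist_Icc hσ hR, Fintype.card_fin]
  have hs : √(2 / π) = √(2 * π) / π := by
    rw [show 2 / π = 2 * π / π ^ 2 by field_simp, Real.sqrt_div (by positivity),
      Real.sqrt_sq pi_pos.le]
  have hq : √(2 * π) ^ 2 = 2 * π := Real.sq_sqrt (by positivity)
  rw [hs]
  field_simp
  linear_combination σ ^ 2 * hq
end
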